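/- Let Λ be the D6 lattice: {x ∈ ℤ^6 : x₁ + ⋯ + x₆ is even} with B(x,y) = −(x₁y₁ + ⋯ + x₆y₆). Then: (i) the radical R ⊆ Λ/2Λ has exactly 4 elements; (ii) exactly 32 classes in Λ/2Λ satisfy q₀ = 1; (iii) exactly 2 elements of R satisfy q₀ = 1, and both of them lie in R₁; (iv) a class v with q₀(v) = 1 contains a root (an element e with B(e,e) = −2) if and only if v ∉ R; in particular exactly 30 classes contain a root. -/

import Mathlib

open Matrix

/-- The D_n lattice: integer vectors with even coordinate sum. -/
def Dn (n : ℕ) : Submodule ℤ (Fin n → ℤ) where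
  carrier := {x | (2 : ℤ) ∣ ∑ i, x i}
  add_mem' := by
    intro a b ha hb
    simpa [Finset.sum_add_distrib] using dvd_add ha hb
  zero_mem' := by simp
  smul_mem' := by
    intro c x hx
    simpa [smul_eq_mul, ← Finset.mul_sum] using hx.mul_left c

/-- The bilinear form of the D6 lattice: `B x y = -(x · y)`. -/
def D6form (x y : Dn 6) : ℤ := -((x : Fin 6 → ℤ) ⬝ᵥ (y : Fin 6 → ℤ))

/-- The submodule `2Λ ⊆ Λ`. -/
def twoSub (M : Type*) [AddCommGroup M] [Module ℤ M] : Submodule ℤ M :=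
  LinearMap.range ((2 : ℤ) • (LinearMap.id : M →ₗ[ℤ] M))

/-- The quotient `Λ/2Λ` for the D6 lattice. -/
abbrev V6 : Type := (Dn 6) ⧸ twoSub (Dn 6)

/-- `q₀(c) = 1`: the class `c` has a representative `v` with `B v v / 2` odd. -/
def q0one (c : V6) : Prop :=
  ∃ v : Dn 6, Submodule.Quotient.mk v = c ∧ (D6form v v / 2) % 2 = 1

/-- `c` lies in the radical `R`. -/
def inRad (c : V6) : Prop :=
  ∃ v : Dn 6, Submodule.Quotient.mk v = c ∧ ∀ w : Dn 6, (2 : ℤ) ∣ D6form v w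

/-- `c ∈ R₁`: `c` lies in the radical and `q(c) = 1 ∈ ℤ/4`. -/
def inR1 (c : V6) : Prop :=
  ∃ v : Dn 6, Submodule.Quotient.mk v = c ∧
    (∀ w : Dn 6, (2 : ℤ) ∣ D6form v w) ∧ (D6form v v / 2) % 4 = 1

/-- `c` contains a root, i.e. a representative `e` with `B e e = -2`. -/
def hasRoot (c : V6) : Prop :=
  ∃ e : Dn 6, Submodule.Quotient.mk e = c ∧ D6form e e = -2

theorem D6_mk_eq_mk_iff (v w : Dn 6) :
    (Submodule.Quotient.mk v : V6) = Submodule.Quotient.mk w ↔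
      (∀ i, (2 : ℤ) ∣ v.1 i - w.1 i) ∧ (4 : ℤ) ∣ ∑ i, v.1 i - ∑ i, w.1 i := by
  rw [Submodule.Quotient.eq, twoSub, LinearMap.mem_range]
  constructor
  · rintro ⟨u, hu⟩
    have h (i : Fin 6) : v.1 i - w.1 i = 2 * u.1 i := by
      simpa using (congrArg (fun x : Dn 6 => x.1 i) hu).symm
    refine ⟨fun i => ⟨_, h i⟩, ?_⟩
    obtain ⟨k, hk⟩ : (2 : ℤ) ∣ ∑ i, u.1 i := u.2
    refine ⟨k, ?_⟩
    rw [← Finset.sum_sub_distrib, Finset.sum_congr rfl fun i _ => h i, ← Finset.mul_sum, hk]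
    ring
  · rintro ⟨h, k, hk⟩
    choose u hu using h
    refine ⟨⟨u, k, ?_⟩, ?_⟩
    · rw [← Finset.sum_sub_distrib, Finset.sum_congr rfl fun i _ => hu i, ← Finset.mul_sum] at hk
      linarith
    · ext i
      simpa using (hu i).symm

theorem D6form_self (v : Dn 6) : D6form v v = -∑ i, v.1 i * v.1 i := rfl

theorem D6form_self_emod_four {v w : Dn 6} (h : ∀ i, (2 : ℤ) ∣ v.1 i - w.1 i) :
    D6form v v % 4 = D6form w w % 4 := by
  refine Int.ModEq.neg (Int.ModEq.sum fun i _ => ?_)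
  obtain ⟨k, hk⟩ := h i
  rw [eq_add_of_sub_eq hk]
  exact (Int.modEq_iff_dvd.2 ⟨-(k * k + k * w.1 i), by ring⟩)

theorem q0one_mk (v : Dn 6) :
    q0one (Submodule.Quotient.mk v) ↔ (D6form v v / 2) % 2 = 1 := by
  refine ⟨?_, fun h => ⟨v, rfl, h⟩⟩
  rintro ⟨w, hw, h⟩
  have := D6form_self_emod_four ((D6_mk_eq_mk_iff w v).1 hw).1
  omega

theorem D6form_even_iff (v : Dn 6) :
    (∀ w : Dn 6, (2 : ℤ) ∣ D6form v w) ↔ ∀ i, (2 : ℤ) ∣ v.1 i - v.1 0 := by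
  constructor
  · intro h i
    have := h ⟨Pi.single 0 1 - Pi.single i 1, by simp [Dn]⟩
    simpa [D6form, dotProduct_sub] using this
  · intro h w
    have hw : (2 : ℤ) ∣ ∑ i, w.1 i := w.2
    have e : v.1 ⬝ᵥ w.1 = ∑ i, (v.1 i - v.1 0) * w.1 i + v.1 0 * ∑ i, w.1 i := by
      simp only [dotProduct, Finset.mul_sum, ← Finset.sum_add_distrib]
      exact Finset.sum_congr rfl fun i _ => by ring
    rw [D6form, dvd_neg, e]
    exact dvd_add (Finset.dvd_sum fun i _ => (h i).mul_right _) (hw.mul_left _)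

theorem inRad_mk (v : Dn 6) :
    inRad (Submodule.Quotient.mk v) ↔ ∀ i, (2 : ℤ) ∣ v.1 i - v.1 0 := by
  refine ⟨?_, fun h => ⟨v, rfl, (D6form_even_iff v).2 h⟩⟩
  rintro ⟨w, hw, h⟩ i
  have h1 := (D6form_even_iff w).1 h i
  have h2 := ((D6_mk_eq_mk_iff w v).1 hw).1
  have h3 := h2 i
  have h4 := h2 0
  omega

theorem hasRoot.q0one {c : V6} (h : hasRoot c) : q0one c := by
  obtain ⟨e, he, h⟩ := h
  exact ⟨e, he, by rw [h]; rfl⟩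

theorem hasRoot.not_inRad {c : V6} (h : hasRoot c) : ¬ inRad c := by
  obtain ⟨e, rfl, h⟩ := h
  rw [inRad_mk]
  intro hr
  rw [D6form_self, neg_inj] at h
  by_cases h0 : (2 : ℤ) ∣ e.1 0
  · have : (4 : ℤ) ∣ ∑ i, e.1 i * e.1 i := Finset.dvd_sum fun i _ => by
      have h2 : (2 : ℤ) ∣ e.1 i := (dvd_iff_dvd_of_dvd_sub (hr i)).2 h0
      exact mul_dvd_mul h2 h2
    omega
  · have : ∑ _i : Fin 6, (1 : ℤ) ≤ ∑ i, e.1 i * e.1 i := Finset.sum_le_sum fun i _ => by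
      have : e.1 i ≠ 0 := fun hi => h0 ((dvd_iff_dvd_of_dvd_sub (hr i)).1 (hi ▸ dvd_zero 2))
      have := mul_self_pos.2 this
      omega
    simp at this
    omega

/-- A representative of each class of `Λ/2Λ`: the first five coordinates of `a` give the first
five parities, and the last one gives half the coordinate sum modulo 2. -/
def repFun (a : Fin 6 → Fin 2) (i : Fin 6) : ℤ :=
  if i = 5 then a 0 + a 1 + a 2 + a 3 + a 4 + 2 * a 5 else a i

/-- `repFun a` as an element of the D6 lattice. -/
def rep (a : Fin 6 → Fin 2) : Dn 6 :=
  ⟨repFun a, a 0 + a 1 + a 2 + a 3 + a 4 + a 5, by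
    simp [repFun, Fin.sum_univ_six, Fin.ext_iff]; ring⟩

theorem bijective_mk_rep :
    Function.Bijective fun a => (Submodule.Quotient.mk (rep a) : V6) := by
  constructor
  · intro a b h
    obtain ⟨h, hs⟩ := (D6_mk_eq_mk_iff _ _).1 h
    have h0 := h 0
    have h1 := h 1
    have h2 := h 2
    have h3 := h 3
    have h4 := h 4
    simp [rep, repFun, Fin.sum_univ_six, Fin.ext_iff] at h0 h1 h2 h3 h4 hs
    ext i
    fin_cases i <;> simp <;> omega
  · intro c
    obtain ⟨v, rfl⟩ := Submodule.Quotient.mk_surjective _ c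
    obtain ⟨k, hk⟩ : (2 : ℤ) ∣ ∑ i, v.1 i := v.2
    let p (z : ℤ) : Fin 2 := ⟨(z % 2).toNat, by omega⟩
    refine ⟨![p (v.1 0), p (v.1 1), p (v.1 2), p (v.1 3), p (v.1 4),
      p (k - v.1 0 - v.1 1 - v.1 2 - v.1 3 - v.1 4)], (D6_mk_eq_mk_iff _ _).2 ⟨fun i => ?_, ?_⟩⟩
    · rw [Fin.sum_univ_six] at hk
      fin_cases i <;> simp [rep, repFun, p, Fin.ext_iff] <;> omega
    · rw [hk]
      simp [rep, repFun, p, Fin.sum_univ_six, Fin.ext_iff]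
      omega

/-- The classes of `Λ/2Λ`, parametrized by their representatives `rep a`. -/
noncomputable def repEquiv : (Fin 6 → Fin 2) ≃ V6 := Equiv.ofBijective _ bijective_mk_rep

theorem card_eq_card_filter (P : V6 → Prop) (Q : (Fin 6 → Fin 2) → Prop) [DecidablePred Q]
    (h : ∀ a, P (Submodule.Quotient.mk (rep a)) ↔ Q a) :
    Nat.card {c : V6 // P c} = (Finset.univ.filter Q).card := by
  rw [← Fintype.card_subtype, ← Nat.card_eq_fintype_card]
  exact (Nat.card_congr (repEquiv.subtypeEquiv fun a => (h a).symm)).symm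

/-- The representative `rep a` has `q₀ = 1`. -/
abbrev RepOdd (a : Fin 6 → Fin 2) : Prop :=
  (-∑ i, repFun a i * repFun a i) / 2 % 2 = 1

/-- The representative `rep a` lies in the radical. -/
abbrev RepRad (a : Fin 6 → Fin 2) : Prop :=
  ∀ i, (2 : ℤ) ∣ repFun a i - repFun a 0

theorem D6form_rep (a : Fin 6 → Fin 2) :
    D6form (rep a) (rep a) = -∑ i, repFun a i * repFun a i := rfl

theorem q0one_mk_rep (a : Fin 6 → Fin 2) : q0one (Submodule.Quotient.mk (rep a)) ↔ RepOdd a := by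
  rw [q0one_mk, D6form_rep]

theorem inRad_mk_rep (a : Fin 6 → Fin 2) : inRad (Submodule.Quotient.mk (rep a)) ↔ RepRad a :=
  inRad_mk (rep a)

/-- The vector `± e_i + e_j` (for `i ≠ j`). -/
def rootFun (i j : Fin 6) (s : Bool) (k : Fin 6) : ℤ :=
  if k = i then (if s then 1 else -1) else if k = j then 1 else 0

theorem exists_root_of_repOdd : ∀ a, RepOdd a → ¬ RepRad a → ∃ i j s,
    ((∀ k, (2 : ℤ) ∣ rootFun i j s k - repFun a k) ∧
      (4 : ℤ) ∣ ∑ k, rootFun i j s k - ∑ k, repFun a k) ∧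
    (2 : ℤ) ∣ ∑ k, rootFun i j s k ∧ ∑ k, rootFun i j s k * rootFun i j s k = 2 := by
  decide +kernel

theorem hasRoot_iff (c : V6) : hasRoot c ↔ q0one c ∧ ¬ inRad c := by
  refine ⟨fun h => ⟨h.q0one, h.not_inRad⟩, ?_⟩
  obtain ⟨a, rfl⟩ := bijective_mk_rep.2 c
  rintro ⟨hq, hr⟩
  obtain ⟨i, j, s, he, hs, hn⟩ :=
    exists_root_of_repOdd a ((q0one_mk_rep a).1 hq) (mt (inRad_mk_rep a).2 hr)
  exact ⟨⟨rootFun i j s, hs⟩, (D6_mk_eq_mk_iff _ _).2 he, by rw [D6form_self, hn]⟩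

theorem emod_four_of_repRad_of_repOdd : ∀ a, RepRad a → RepOdd a →
    (-∑ i, repFun a i * repFun a i) / 2 % 4 = 1 := by
  decide +kernel

/-- For the D6 lattice: (i) the radical of `Λ/2Λ` has exactly 4
elements; (ii) exactly 32 classes satisfy `q₀ = 1`; (iii) exactly 2 elements of the
radical satisfy `q₀ = 1` and both of them lie in `R₁`; (iv) a class with `q₀ = 1`
contains a root iff it is not in the radical; in particular exactly 30 classes
contain a root. -/
theorem stmt_6 :
    Nat.card {c : V6 // inRad c} = 4 ∧
    Nat.card {c : V6 // q0one c} = 32 ∧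
    (Nat.card {c : V6 // inRad c ∧ q0one c} = 2 ∧
      ∀ c : V6, inRad c → q0one c → inR1 c) ∧
    (∀ c : V6, q0one c → (hasRoot c ↔ ¬ inRad c)) ∧
    Nat.card {c : V6 // hasRoot c} = 30 := by
  refine ⟨?_, ?_, ⟨?_, ?_⟩, fun c hc => by simp [hasRoot_iff, hc], ?_⟩
  · rw [card_eq_card_filter inRad RepRad inRad_mk_rep]
    decide +kernel
  · rw [card_eq_card_filter q0one RepOdd q0one_mk_rep]
    decide +kernel
  · rw [card_eq_card_filter _ (fun a => RepRad a ∧ RepOdd a)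
      fun a => and_congr (inRad_mk_rep a) (q0one_mk_rep a)]
    decide +kernel
  · intro c hr hq
    obtain ⟨a, rfl⟩ := bijective_mk_rep.2 c
    have hr' := (inRad_mk_rep a).1 hr
    refine ⟨rep a, rfl, (D6form_even_iff (rep a)).2 hr', ?_⟩
    rw [D6form_rep]
    exact emod_four_of_repRad_of_repOdd a hr' ((q0one_mk_rep a).1 hq)
  · rw [card_eq_card_filter _ (fun a => RepOdd a ∧ ¬ RepRad a)
      fun a => (hasRoot_iff _).trans (and_congr (q0one_mk_rep a) (not_congr (inRad_mk_rep a)))]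
    decide +kernel
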